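/- Gaussian approximation of the dB-scale per-UE uplink interference power: Let L be a real-valued random variable with mean μ_L = E[L], variance σ_L² > 0, and E[|L − μ_L|³] < ∞, let G be a Gaussian random variable with distribution N(μ_G, σ_G²), σ_G² > 0, independent of L, and let P₀ ∈ ℝ be a constant. Define I_b = P₀ + L + G. Then for all x ∈ ℝ, |P(I_b ≤ x) − Φ((x − μ_{Q_b}) / σ_{Q_b})| ≤ 0.56 · E[|L − μ_L|³] / (√(σ_L² + σ_G²))³, where μ_{Q_b} = P₀ + μ_L + μ_G and σ_{Q_b}² = σ_L² + σ_G²; that is, the Kolmogorov distance between the law of I_b and the Gaussian distribution N(μ_{Q_b}, σ_{Q_b}²) is at most τ = 0.56 · E[|L − μ_L|³] / (√(σ_L² + σ_G²))³. -/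

import Mathlib

open MeasureTheory ProbabilityTheory Real

/-- The standard normal density. -/
noncomputable def stdPDF (t : ℝ) : ℝ := (√(2 * π))⁻¹ * exp (-t ^ 2 / 2)

/-- The standard normal distribution function. -/
noncomputable def stdCDF (t : ℝ) : ℝ := cdf (gaussianReal 0 1) t

lemma gaussianPDFReal_zero_one (t : ℝ) : gaussianPDFReal 0 1 t = stdPDF t := by
  simp [gaussianPDFReal, stdPDF]

lemma stdPDF_pos (t : ℝ) : 0 < stdPDF t := by unfold stdPDF; positivity

lemma stdPDF_neg (t : ℝ) : stdPDF (-t) = stdPDF t := by simp [stdPDF]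

lemma hasDerivAt_stdPDF (t : ℝ) : HasDerivAt stdPDF (-t * stdPDF t) t := by
  have h : HasDerivAt (fun t : ℝ => -t ^ 2 / 2) (-t) t := by
    convert! ((hasDerivAt_pow 2 t).neg.div_const 2) using 1
    push_cast; ring
  convert! (h.exp.const_mul (√(2 * π))⁻¹) using 1
  simp only [stdPDF]; ring

lemma hasDerivAt_stdCDF (t : ℝ) : HasDerivAt stdCDF (stdPDF t) t := by
  have hI : Integrable stdPDF := by
    simpa [funext gaussianPDFReal_zero_one] using integrable_gaussianPDFReal 0 1
  have hcont : Continuous stdPDF := by unfold stdPDF; fun_prop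
  have heq : ∀ s, stdCDF s = stdCDF 0 + ∫ u in (0 : ℝ)..s, stdPDF u := by
    have h : ∀ s, stdCDF s = ∫ u in Set.Iic s, stdPDF u := by
      intro s
      rw [stdCDF, cdf_eq_real, measureReal_def, gaussianReal_apply_eq_integral 0 one_ne_zero,
        ENNReal.toReal_ofReal]
      · simp only [gaussianPDFReal_zero_one]
      · exact integral_nonneg fun u => gaussianPDFReal_nonneg _ _ _
    intro s
    rw [h, h, ← intervalIntegral.integral_Iic_sub_Iic hI.integrableOn hI.integrableOn]
    ring
  rw [funext heq]
  exact (intervalIntegral.integral_hasDerivAt_right (hcont.intervalIntegrable _ _)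
    (hcont.stronglyMeasurableAtFilter _ _) hcont.continuousAt).const_add _

lemma stdCDF_mono : Monotone stdCDF := monotone_cdf _

lemma stdCDF_nonneg (t : ℝ) : 0 ≤ stdCDF t := cdf_nonneg _ _

lemma stdCDF_le_one (t : ℝ) : stdCDF t ≤ 1 := cdf_le_one _ _

lemma stdCDF_neg (t : ℝ) : stdCDF (-t) = 1 - stdCDF t := by
  have : NullSingletonClass (gaussianReal 0 1) := nullSingletonClass_gaussianReal one_ne_zero
  have h1 : (gaussianReal 0 1).real (Set.Iic (-t)) = (gaussianReal 0 1).real (Set.Ici t) := by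
    conv_lhs => rw [← neg_zero, ← gaussianReal_map_neg]
    rw [map_measureReal_apply measurable_neg measurableSet_Iic]
    congr 1; ext; simp
  rw [stdCDF, stdCDF, cdf_eq_real, cdf_eq_real, h1, ← Set.compl_Iio,
    probReal_compl_eq_one_sub measurableSet_Iio, measureReal_congr Iio_ae_eq_Iic]

lemma stdCDF_zero : stdCDF 0 = 1 / 2 := by
  have := stdCDF_neg 0
  rw [neg_zero] at this; linarith

/-- A function that starts nonnegative and has nonnegative derivative stays nonnegative. -/
lemma nonneg_of_hasDerivAt_nonneg {g g' : ℝ → ℝ} (h0 : 0 ≤ g 0)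
    (hg : ∀ t, HasDerivAt g (g' t) t) (hg' : ∀ t, 0 ≤ t → 0 ≤ g' t) {t : ℝ} (ht : 0 ≤ t) :
    0 ≤ g t := by
  have : MonotoneOn g (Set.Ici 0) := by
    apply monotoneOn_of_deriv_nonneg (convex_Ici 0)
    · exact fun s _ => (hg s).continuousAt.continuousWithinAt
    · exact fun s _ => (hg s).differentiableAt.differentiableWithinAt
    · intro s hs
      rw [interior_Ici] at hs
      rw [(hg s).deriv]; exact hg' s (le_of_lt hs)
  exact h0.trans (this (Set.mem_Ici.2 le_rfl) ht ht)

/-- One-sided second-order Taylor bound. -/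
lemma taylor_two_upper {f f' f'' : ℝ → ℝ} {K : ℝ} (hf : ∀ t, HasDerivAt f (f' t) t)
    (hf' : ∀ t, HasDerivAt f' (f'' t) t) (hK : ∀ t, f'' t ≤ K) (v u : ℝ) :
    f (v + u) ≤ f v + f' v * u + K / 2 * u ^ 2 := by
  have key : ∀ (f f' f'' : ℝ → ℝ), (∀ t, HasDerivAt f (f' t) t) →
      (∀ t, HasDerivAt f' (f'' t) t) → (∀ t, f'' t ≤ K) → ∀ u, 0 ≤ u →
      f u ≤ f 0 + f' 0 * u + K / 2 * u ^ 2 := by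
    intro f f' f'' hf hf' hK u hu
    have h1 : ∀ u, 0 ≤ u → 0 ≤ f' 0 + K * u - f' u := fun u hu =>
      nonneg_of_hasDerivAt_nonneg (g := fun u => f' 0 + K * u - f' u) (g' := fun u => K - f'' u)
        (by simp) (fun t => by
          convert! ((((hasDerivAt_id t).const_mul K).const_add (f' 0)).sub (hf' t)) using 1
          simp) (fun t _ => sub_nonneg.2 (hK t)) hu
    have h2 := nonneg_of_hasDerivAt_nonneg (g := fun u => f 0 + f' 0 * u + K / 2 * u ^ 2 - f u)
        (g' := fun u => f' 0 + K * u - f' u) (by simp) (fun t => by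
          convert! (((((hasDerivAt_id t).const_mul (f' 0)).const_add (f 0)).add
            ((hasDerivAt_pow 2 t).const_mul (K / 2))).sub (hf t)) using 1
          simp; ring) h1 hu
    linarith
  rcases le_total 0 u with hu | hu
  · have := key (fun t => f (v + t)) (fun t => f' (v + t)) (fun t => f'' (v + t))
      (fun t => (hf (v + t)).comp_const_add v t) (fun t => (hf' (v + t)).comp_const_add v t)
      (fun t => hK _) u hu
    simpa using this
  · have := key (fun t => f (v - t)) (fun t => -f' (v - t)) (fun t => f'' (v - t))
      (fun t => (hf (v - t)).comp_const_sub v t)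
      (fun t => by simpa using ((hf' (v - t)).comp_const_sub v t).fun_neg)
      (fun t => hK _) (-u) (by linarith)
    simp at this; linarith

/-- One-sided third-order Taylor bound. -/
lemma taylor_three_upper {f f' f'' f''' : ℝ → ℝ} {M : ℝ} (hf : ∀ t, HasDerivAt f (f' t) t)
    (hf' : ∀ t, HasDerivAt f' (f'' t) t) (hf'' : ∀ t, HasDerivAt f'' (f''' t) t)
    (hM : ∀ t, |f''' t| ≤ M) (v u : ℝ) :
    f (v + u) ≤ f v + f' v * u + f'' v / 2 * u ^ 2 + M / 6 * |u| ^ 3 := by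
  have key : ∀ (f f' f'' f''' : ℝ → ℝ), (∀ t, HasDerivAt f (f' t) t) →
      (∀ t, HasDerivAt f' (f'' t) t) → (∀ t, HasDerivAt f'' (f''' t) t) → (∀ t, f''' t ≤ M) →
      ∀ u, 0 ≤ u → f u ≤ f 0 + f' 0 * u + f'' 0 / 2 * u ^ 2 + M / 6 * u ^ 3 := by
    intro f f' f'' f''' hf hf' hf'' hM u hu
    have h1 : ∀ u, 0 ≤ u → 0 ≤ f'' 0 + M * u - f'' u := fun u hu =>
      nonneg_of_hasDerivAt_nonneg (g := fun u => f'' 0 + M * u - f'' u)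
        (g' := fun u => M - f''' u)
        (by simp) (fun t => by
          convert! ((((hasDerivAt_id t).const_mul M).const_add (f'' 0)).sub (hf'' t)) using 1
          simp) (fun t _ => sub_nonneg.2 (hM t)) hu
    have h2 : ∀ u, 0 ≤ u → 0 ≤ f' 0 + f'' 0 * u + M / 2 * u ^ 2 - f' u := fun u hu =>
      nonneg_of_hasDerivAt_nonneg (g := fun u => f' 0 + f'' 0 * u + M / 2 * u ^ 2 - f' u)
        (g' := fun u => f'' 0 + M * u - f'' u) (by simp) (fun t => by
          convert! (((((hasDerivAt_id t).const_mul (f'' 0)).const_add (f' 0)).add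
            ((hasDerivAt_pow 2 t).const_mul (M / 2))).sub (hf' t)) using 1
          simp; ring) h1 hu
    have h3 := nonneg_of_hasDerivAt_nonneg
        (g := fun u => f 0 + f' 0 * u + f'' 0 / 2 * u ^ 2 + M / 6 * u ^ 3 - f u)
        (g' := fun u => f' 0 + f'' 0 * u + M / 2 * u ^ 2 - f' u) (by simp) (fun t => by
          convert! ((((((hasDerivAt_id t).const_mul (f' 0)).const_add (f 0)).add
            ((hasDerivAt_pow 2 t).const_mul (f'' 0 / 2))).add
            ((hasDerivAt_pow 3 t).const_mul (M / 6))).sub (hf t)) using 1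
          simp; ring) h2 hu
    linarith
  rcases le_total 0 u with hu | hu
  · have := key (fun t => f (v + t)) (fun t => f' (v + t)) (fun t => f'' (v + t))
      (fun t => f''' (v + t))
      (fun t => (hf (v + t)).comp_const_add v t) (fun t => (hf' (v + t)).comp_const_add v t)
      (fun t => (hf'' (v + t)).comp_const_add v t)
      (fun t => (le_abs_self _).trans (hM _)) u hu
    simpa [abs_of_nonneg hu] using this
  · have := key (fun t => f (v - t)) (fun t => -f' (v - t)) (fun t => f'' (v - t))
      (fun t => -f''' (v - t))
      (fun t => (hf (v - t)).comp_const_sub v t)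
      (fun t => by simpa using ((hf' (v - t)).comp_const_sub v t).fun_neg)
      (fun t => (hf'' (v - t)).comp_const_sub v t)
      (fun t => (neg_le_abs _).trans (hM _)) (-u) (by linarith)
    simp at this
    rw [abs_of_nonpos hu]; linarith

lemma inv_sqrt_two_pi_bounds : 0.3989 ≤ (√(2 * π))⁻¹ ∧ (√(2 * π))⁻¹ ≤ 0.39895 := by
  have h0 : 0 < √(2 * π) := by positivity
  have h1 : (√(2 * π)) ^ 2 = 2 * π := sq_sqrt (by positivity)
  have h2 := pi_gt_d4
  have h3 := pi_lt_d4
  constructor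
  · rw [le_inv_comm₀ (by norm_num) h0]
    refine le_of_sq_le_sq ?_ ?_ <;> norm_num at *
    nlinarith
  · rw [inv_le_comm₀ h0 (by norm_num)]
    apply le_of_sq_le_sq _ h0.le
    rw [h1]; norm_num at *; linarith

lemma stdPDF_zero_bounds : 0.3989 ≤ stdPDF 0 ∧ stdPDF 0 ≤ 0.39895 := by
  simpa [stdPDF] using inv_sqrt_two_pi_bounds

lemma exp_neg_le_quadratic {s : ℝ} (hs : 0 ≤ s) : exp (-s) ≤ 1 - s + s ^ 2 / 2 := by
  have h := nonneg_of_hasDerivAt_nonneg (g := fun s => 1 - s + s ^ 2 / 2 - exp (-s))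
    (g' := fun s => -1 + s + exp (-s)) (by simp) (fun t => by
      convert! (((((hasDerivAt_id t).const_sub 1).add ((hasDerivAt_pow 2 t).div_const 2))).sub
        (hasDerivAt_neg t).exp) using 1
      push_cast; ring) (fun t _ => by linarith [add_one_le_exp (-t)]) hs
  linarith

lemma cubic_le_exp_neg {s : ℝ} (hs : 0 ≤ s) : 1 - s + s ^ 2 / 2 - s ^ 3 / 6 ≤ exp (-s) := by
  have h := nonneg_of_hasDerivAt_nonneg
    (g := fun s => exp (-s) - (1 - s + s ^ 2 / 2 - s ^ 3 / 6))
    (g' := fun s => 1 - s + s ^ 2 / 2 - exp (-s)) (by simp) (fun t => by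
      convert! ((hasDerivAt_neg t).exp.sub ((((hasDerivAt_id t).const_sub 1).add
        ((hasDerivAt_pow 2 t).div_const 2)).sub ((hasDerivAt_pow 3 t).div_const 6))) using 1
      push_cast; ring) (fun t ht => by linarith [exp_neg_le_quadratic ht]) hs
  linarith

lemma stdPDF_eq (t : ℝ) : stdPDF t = stdPDF 0 * exp (-(t ^ 2 / 2)) := by
  simp [stdPDF, neg_div]

lemma hasDerivAt_quintic (t : ℝ) : HasDerivAt (fun t : ℝ => t - t ^ 3 / 6 + t ^ 5 / 40)
    (1 - t ^ 2 / 2 + (t ^ 2 / 2) ^ 2 / 2) t := by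
  convert! (((hasDerivAt_id t).sub ((hasDerivAt_pow 3 t).div_const 6)).add
    ((hasDerivAt_pow 5 t).div_const 40)) using 1
  push_cast; ring

lemma stdCDF_le_quintic {v : ℝ} (hv : 0 ≤ v) :
    stdCDF v ≤ 1 / 2 + stdPDF 0 * (v - v ^ 3 / 6 + v ^ 5 / 40) := by
  have h := nonneg_of_hasDerivAt_nonneg
    (g := fun v => 1 / 2 + stdPDF 0 * (v - v ^ 3 / 6 + v ^ 5 / 40) - stdCDF v)
    (by simp [stdCDF_zero])
    (fun t => ((((hasDerivAt_quintic t).const_mul (stdPDF 0)).const_add (1 / 2)).sub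
        (hasDerivAt_stdCDF t))) (fun t _ => by
      rw [stdPDF_eq t, ← mul_sub]
      exact mul_nonneg (stdPDF_pos 0).le
        (sub_nonneg.2 (exp_neg_le_quadratic (by positivity)))) hv
  linarith

lemma septic_le_stdCDF {v : ℝ} (hv : 0 ≤ v) :
    1 / 2 + stdPDF 0 * (v - v ^ 3 / 6 + v ^ 5 / 40 - v ^ 7 / 336) ≤ stdCDF v := by
  have h := nonneg_of_hasDerivAt_nonneg
    (g := fun v => stdCDF v -
      (1 / 2 + stdPDF 0 * (v - v ^ 3 / 6 + v ^ 5 / 40 - v ^ 7 / 336)))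
    (by simp [stdCDF_zero])
    (fun t => ((hasDerivAt_stdCDF t).sub ((((hasDerivAt_quintic t).sub
        ((hasDerivAt_pow 7 t).div_const 336)).const_mul (stdPDF 0)).const_add (1 / 2))))
    (fun t _ => by
      rw [stdPDF_eq t, ← mul_sub]
      refine mul_nonneg (stdPDF_pos 0).le
        (sub_nonneg.2 (le_trans (le_of_eq ?_) (cubic_le_exp_neg (by positivity))))
      push_cast; ring) hv
  linarith

/-- Lower polynomial bound for the normal distribution function on the negative axis. -/
lemma quintic_le_stdCDF_neg {z : ℝ} (hz : 0 ≤ z) :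
    1 / 2 - 0.39895 * (z - z ^ 3 / 6 + z ^ 5 / 40) ≤ stdCDF (-z) := by
  have hP : 0 ≤ z - z ^ 3 / 6 + z ^ 5 / 40 := by
    have h2 : z - z ^ 3 / 6 + z ^ 5 / 40 = z * ((z ^ 2 - 10 / 3) ^ 2 / 40 + 13 / 18) := by ring
    rw [h2]; positivity
  rw [stdCDF_neg]
  nlinarith [stdCDF_le_quintic hz, mul_le_mul_of_nonneg_right stdPDF_zero_bounds.2 hP]

lemma stdCDF_neg_one_le : stdCDF (-1) ≤ 0.16 := by
  rw [stdCDF_neg]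
  have h := septic_le_stdCDF (v := 1) (by norm_num)
  have := stdPDF_zero_bounds.1
  norm_num at *; linarith

lemma stdCDF_neg_seven_fifths_le : stdCDF (-1.4) ≤ 0.09 := by
  rw [stdCDF_neg]
  have h := septic_le_stdCDF (v := 1.4) (by norm_num)
  have := stdPDF_zero_bounds.1
  norm_num at *; linarith

lemma le_stdCDF_082 : 0.792 ≤ stdCDF 0.82 := by
  have h := septic_le_stdCDF (v := 0.82) (by norm_num)
  have := stdPDF_zero_bounds.1
  norm_num at *; linarith

lemma le_stdCDF_037 : 0.644 ≤ stdCDF 0.37 := by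
  have h := septic_le_stdCDF (v := 0.37) (by norm_num)
  have := stdPDF_zero_bounds.1
  norm_num at *; linarith

lemma linear_le_stdCDF {x : ℝ} (h0 : 0 ≤ x) (h1 : x ≤ 0.37) : 1 / 2 + 0.38 * x ≤ stdCDF x := by
  have h := septic_le_stdCDF h0
  have hb := stdPDF_zero_bounds.1
  have h2 : 0.97 * x ≤ x - x ^ 3 / 6 + x ^ 5 / 40 - x ^ 7 / 336 := by
    have hx2 : x ^ 2 ≤ 0.1369 := by nlinarith
    have : x - x ^ 3 / 6 + x ^ 5 / 40 - x ^ 7 / 336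
      = x * (1 - x ^ 2 / 6 + (x ^ 2) ^ 2 / 40 * (1 - x ^ 2 * (40 / 336))) := by ring
    rw [this, mul_comm]
    apply mul_le_mul_of_nonneg_left _ h0
    have : 0 ≤ (x ^ 2) ^ 2 / 40 * (1 - x ^ 2 * (40 / 336)) :=
      mul_nonneg (by positivity) (by norm_num at *; linarith)
    norm_num at *; linarith
  have h3 : 0.38 * x ≤ stdPDF 0 * (0.97 * x) := by norm_num at *; nlinarith
  have h4 := mul_le_mul_of_nonneg_left h2 (stdPDF_pos 0).le
  linarith

lemma exp_neg_half_le : exp (-(1 / 2)) ≤ 0.60655 := by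
  have h : exp (-(1 / 2)) ^ 2 = exp (-1) := by rw [← exp_nat_mul]; norm_num
  have h1 := exp_neg_one_lt_d9
  refine le_of_sq_le_sq ?_ (by norm_num)
  rw [h]; norm_num at *; linarith

lemma le_exp_neg_four_fifths : 0.4493 ≤ exp (-0.8) := by
  have h : exp (-0.8) ^ 5 = exp (-1) ^ 4 := by
    rw [← exp_nat_mul, ← exp_nat_mul]; norm_num
  have h1 := exp_neg_one_gt_d9
  refine le_of_pow_le_pow_left₀ (n := 5) (by norm_num) (exp_pos _).le ?_
  rw [h]
  refine le_trans ?_ (pow_le_pow_left₀ (by norm_num) h1.le 4)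
  norm_num

lemma neg_mul_stdPDF_le (t : ℝ) : -t * stdPDF t ≤ 0.242 := by
  have h : -t ≤ exp (t ^ 2 / 2 - 1 / 2) := by
    nlinarith [add_one_le_exp (t ^ 2 / 2 - 1 / 2), sq_nonneg (t + 1)]
  have h2 : -t * exp (-(t ^ 2 / 2)) ≤ exp (-(1 / 2)) := by
    refine (mul_le_mul_of_nonneg_right h (exp_pos _).le).trans (le_of_eq ?_)
    rw [← exp_add]; congr 1; ring
  rw [stdPDF_eq]
  have h3 := mul_le_mul_of_nonneg_left (h2.trans exp_neg_half_le) (stdPDF_pos 0).le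
  have := stdPDF_zero_bounds.2
  norm_num at *; nlinarith

lemma hasDerivAt_neg_mul_stdPDF (t : ℝ) :
    HasDerivAt (fun t => -t * stdPDF t) ((t ^ 2 - 1) * stdPDF t) t := by
  convert! (hasDerivAt_neg t).mul (hasDerivAt_stdPDF t) using 1
  ring

lemma abs_sq_sub_one_mul_stdPDF_le (t : ℝ) : |(t ^ 2 - 1) * stdPDF t| ≤ 0.399 := by
  have he := quadratic_le_exp_of_nonneg (x := t ^ 2 / 2) (by positivity)
  have h1 : |t ^ 2 - 1| ≤ exp (t ^ 2 / 2) := by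
    rw [abs_le]
    constructor <;> nlinarith [sq_nonneg (t ^ 2 - 2), sq_nonneg t]
  rw [abs_mul, abs_of_pos (stdPDF_pos t), stdPDF_eq]
  have h2 : |t ^ 2 - 1| * exp (-(t ^ 2 / 2)) ≤ 1 := by
    refine (mul_le_mul_of_nonneg_right h1 (exp_pos _).le).trans (le_of_eq ?_)
    rw [← exp_add]; simp
  have := stdPDF_zero_bounds.2
  have h3 := mul_le_mul_of_nonneg_left h2 (stdPDF_pos 0).le
  norm_num at *; linarith

lemma stdCDF_add_le_two (v u : ℝ) :
    stdCDF (v + u) ≤ stdCDF v + stdPDF v * u + 0.121 * u ^ 2 := by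
  have := taylor_two_upper hasDerivAt_stdCDF hasDerivAt_stdPDF neg_mul_stdPDF_le v u
  norm_num at *; linarith

lemma stdCDF_add_le_three (v u : ℝ) :
    stdCDF (v + u) ≤ stdCDF v + stdPDF v * u + -v * stdPDF v / 2 * u ^ 2
      + 0.0665 * |u| ^ 3 := by
  have := taylor_three_upper hasDerivAt_stdCDF hasDerivAt_stdPDF hasDerivAt_neg_mul_stdPDF
    abs_sq_sub_one_mul_stdPDF_le v u
  norm_num at *; linarith

/-- Lower bound for the normal mass of `[z, 1.95 z]`. -/
lemma stdCDF_neg_gap {z : ℝ} (h0 : 0.4 ≤ z) (h1 : z ≤ 1) :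
    stdCDF (-(1.95 * z)) + 0.11 ≤ stdCDF (-z) := by
  set k := stdPDF 0 * exp (-0.8) with hk
  have hkb : 0.3989 * 0.4493 ≤ k := mul_le_mul stdPDF_zero_bounds.1 le_exp_neg_four_fifths
    (by norm_num) (stdPDF_pos 0).le
  have hd : ∀ t, HasDerivAt (fun w => stdCDF w - k * (1.8 * w - w ^ 3 / 6))
      (stdPDF t - k * (1.8 - t ^ 2 / 2)) t := fun t => by
    convert! (hasDerivAt_stdCDF t).sub ((((hasDerivAt_id t).const_mul 1.8).sub
      ((hasDerivAt_pow 3 t).div_const 6)).const_mul k) using 1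
    push_cast; ring
  have hm : Monotone (fun w => stdCDF w - k * (1.8 * w - w ^ 3 / 6)) := by
    refine monotone_of_hasDerivAt_nonneg hd fun t => ?_
    rw [stdPDF_eq, hk, mul_assoc, Pi.zero_apply, ← mul_sub]
    refine mul_nonneg (stdPDF_pos 0).le (sub_nonneg.2 ?_)
    have : exp (-(t ^ 2 / 2)) = exp (-0.8) * exp (0.8 - t ^ 2 / 2) := by
      rw [← exp_add]; congr 1; ring
    rw [this]
    refine mul_le_mul_of_nonneg_left ?_ (exp_pos _).le
    have := add_one_le_exp (0.8 - t ^ 2 / 2)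
    norm_num at *; linarith
  have h := hm (show z ≤ 1.95 * z by norm_num at *; linarith)
  have hpoly : 0.615 ≤ 1.8 * (1.95 * z) - (1.95 * z) ^ 3 / 6 - (1.8 * z - z ^ 3 / 6) := by
    norm_num at *
    nlinarith [mul_nonneg (sub_nonneg.2 h0) (sub_nonneg.2 h1),
      mul_nonneg (mul_nonneg (sub_nonneg.2 h0) (sub_nonneg.2 h1)) (by linarith : 0 ≤ z)]
  have h2 := mul_le_mul hkb hpoly (by norm_num) (le_trans (by norm_num) hkb)
  rw [stdCDF_neg, stdCDF_neg]
  simp only at h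
  norm_num at *; linarith

/-- `ν` is a centered law with standard deviation `a` and a finite third absolute moment. -/
structure IsCenteredLaw (ν : Measure ℝ) (a : ℝ) : Prop where
  integrable_cube : Integrable (fun y => |y| ^ 3) ν
  mean : ∫ y, y ∂ν = 0
  second : ∫ y, y ^ 2 ∂ν = a ^ 2

section CenteredLaw

variable {ν : Measure ℝ} [IsProbabilityMeasure ν] {a : ℝ}

lemma IsCenteredLaw.integrable_sq (h : IsCenteredLaw ν a) : Integrable (fun y => y ^ 2) ν := by
  refine ((integrable_const (1 : ℝ)).add h.integrable_cube).mono'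
    (by fun_prop) (Filter.Eventually.of_forall fun y => ?_)
  rw [norm_of_nonneg (by positivity), ← sq_abs, Pi.add_apply]
  nlinarith [abs_nonneg y, sq_nonneg (|y| - 1), mul_nonneg (abs_nonneg y) (sq_nonneg (|y| - 1))]

lemma IsCenteredLaw.integrable_id (h : IsCenteredLaw ν a) : Integrable (fun y => y) ν := by
  refine ((integrable_const (1 : ℝ)).add h.integrable_sq).mono'
    (by fun_prop) (Filter.Eventually.of_forall fun y => ?_)
  rw [Real.norm_eq_abs, Pi.add_apply]
  nlinarith [sq_nonneg (|y| - 1), abs_nonneg y, sq_abs y]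

lemma IsCenteredLaw.integral_cubic (h : IsCenteredLaw ν a) (A q m k : ℝ) :
    Integrable (fun y => A + q * y + m * y ^ 2 + k * |y| ^ 3) ν ∧
    ∫ y, (A + q * y + m * y ^ 2 + k * |y| ^ 3) ∂ν = A + m * a ^ 2 + k * ∫ y, |y| ^ 3 ∂ν := by
  have i1 := h.integrable_id.const_mul q
  have i2 := h.integrable_sq.const_mul m
  have i3 := h.integrable_cube.const_mul k
  have i0 : Integrable (fun _ : ℝ => A) ν := integrable_const A
  refine ⟨((i0.add i1).add i2).add i3, ?_⟩
  rw [integral_add (by exact (i0.add i1).add i2) i3, integral_add (by exact i0.add i1) i2,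
    integral_add i0 i1, integral_const_mul, integral_const_mul, integral_const_mul, h.mean,
    h.second]
  simp

/-- A pointwise cubic majorant bounds the integral. -/
lemma IsCenteredLaw.integral_le (h : IsCenteredLaw ν a) {f : ℝ → ℝ} (hf : Integrable f ν)
    {A q m k : ℝ} (hle : ∀ y, f y ≤ A + q * y + m * y ^ 2 + k * |y| ^ 3) :
    ∫ y, f y ∂ν ≤ A + m * a ^ 2 + k * ∫ y, |y| ^ 3 ∂ν := by
  rw [← (h.integral_cubic A q m k).2]
  exact integral_mono hf (h.integral_cubic A q m k).1 hle

lemma IsCenteredLaw.cube_le (h : IsCenteredLaw ν a) (ha : 0 ≤ a) :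
    a ^ 3 ≤ ∫ y, |y| ^ 3 ∂ν := by
  have := h.integral_le (f := fun _ => a ^ 3) (integrable_const _) (A := 3 / 2 * a ^ 3) (q := 0)
    (m := -(3 / 2 * a)) (k := 1) fun y => by
      rw [← sq_abs y]
      have : 0 ≤ (|y| - a) ^ 2 * (|y| + a / 2) := by positivity
      nlinarith
  simp at this
  nlinarith

lemma integrable_stdCDF_comp {g : ℝ → ℝ} (hg : Measurable g) :
    Integrable (fun y => stdCDF (g y)) ν := by
  refine Integrable.of_bound (C := 1) (stdCDF_mono.measurable.comp hg).aestronglyMeasurable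
    (Filter.Eventually.of_forall fun y => ?_)
  rw [norm_of_nonneg (stdCDF_nonneg _)]
  exact stdCDF_le_one _

end CenteredLaw

lemma integral_sq_gaussianReal : ∫ y, y ^ 2 ∂(gaussianReal 0 1) = 1 := by
  have h := variance_fun_id_gaussianReal (μ := 0) (v := 1)
  rw [variance_of_integral_eq_zero (by fun_prop) (by simp)] at h
  simpa using h

lemma integral_abs_cube_gaussianReal : ∫ y, |y| ^ 3 ∂(gaussianReal 0 1) ≤ 1.6 := by
  rw [integral_gaussianReal_eq_integral_smul one_ne_zero]
  simp only [gaussianPDFReal_zero_one, smul_eq_mul]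
  have h1 : ∀ y : ℝ, stdPDF y * |y| ^ 3 = (fun t => stdPDF t * t ^ 3) |y| := fun y => by
    simp [stdPDF]
  rw [integral_congr_ae (Filter.Eventually.of_forall h1),
    integral_comp_abs (f := fun t => stdPDF t * t ^ 3)]
  have h2 := integral_rpow_mul_exp_neg_mul_rpow (p := 2) (q := 3) (b := 1 / 2) (by norm_num)
    (by norm_num) (by norm_num)
  have h3 : ∫ t in Set.Ioi (0 : ℝ), stdPDF t * t ^ 3 =
      stdPDF 0 * ∫ t in Set.Ioi (0 : ℝ), t ^ (3 : ℝ) * exp (-(1 / 2) * t ^ (2 : ℝ)) := by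
    rw [← integral_const_mul]
    refine integral_congr_ae (Filter.Eventually.of_forall fun t => ?_)
    simp only
    rw [stdPDF_eq]
    norm_cast
    rw [mul_assoc, mul_comm (exp _)]
    congr 3; ring_nf
  rw [h3, h2]
  have h4 : ((1 : ℝ) / 2) ^ (-(3 + 1) / 2 : ℝ) * (1 / 2) * Gamma ((3 + 1) / 2) = 2 := by
    have e1 : (-(3 + 1) / 2 : ℝ) = ((-2 : ℤ) : ℝ) := by norm_num
    have e2 : ((3 + 1) / 2 : ℝ) = ((1 : ℕ) : ℝ) + 1 := by norm_num
    rw [e1, rpow_intCast, e2, Gamma_nat_eq_factorial]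
    norm_num
  rw [h4]
  have := stdPDF_zero_bounds.2
  norm_num at *; linarith

lemma integrable_abs_cube_gaussianReal : Integrable (fun y => |y| ^ 3) (gaussianReal 0 1) := by
  have := (memLp_id_gaussianReal (μ := 0) (v := 1) 3).integrable_norm_pow (by norm_num)
  simpa using this

lemma isCenteredLaw_gaussianReal : IsCenteredLaw (gaussianReal 0 1) 1 :=
  ⟨integrable_abs_cube_gaussianReal, by simp, by simp [integral_sq_gaussianReal]⟩

lemma gaussianReal_real_Iic {c : ℝ} (hc : 0 < c) {v : NNReal} (hv : (v : ℝ) = c ^ 2) (t : ℝ) :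
    (gaussianReal 0 v).real (Set.Iic t) = stdCDF (t / c) := by
  have h : (gaussianReal 0 1).map (fun n => c * n) = gaussianReal 0 v := by
    rw [gaussianReal_map_const_mul]
    congr 1
    · simp
    · ext; simp [hv]
  rw [← h, map_measureReal_apply (by fun_prop) measurableSet_Iic, stdCDF, cdf_eq_real]
  congr 1; ext n
  simp [le_div_iff₀ hc, mul_comm]

lemma cdf_conv_gaussianReal (ν : Measure ℝ) [IsProbabilityMeasure ν] {c : ℝ} (hc : 0 < c)
    {v : NNReal} (hv : (v : ℝ) = c ^ 2) (x : ℝ) :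
    cdf (ν ∗ gaussianReal 0 v) x = ∫ y, stdCDF ((x - y) / c) ∂ν := by
  rw [cdf_eq_real, Measure.conv, map_measureReal_apply (by fun_prop) measurableSet_Iic,
    measureReal_def, Measure.prod_apply (measurableSet_Iic.preimage (by fun_prop)),
    ← integral_toReal]
  · refine integral_congr_ae (Filter.Eventually.of_forall fun y => ?_)
    simp only
    rw [← gaussianReal_real_Iic hc hv, measureReal_def]
    congr 2; ext n
    simp [le_sub_iff_add_le']
  · exact (measurable_measure_prodMk_left
      (measurableSet_Iic.preimage (by fun_prop))).aemeasurable
  · exact Filter.Eventually.of_forall fun y => measure_lt_top _ _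

/-- Smoothing a normal distribution function by a normal law. -/
lemma integral_stdCDF_gaussianReal {a c : ℝ} (hc : 0 < c) (hac : a ^ 2 + c ^ 2 = 1) (x : ℝ) :
    ∫ n, stdCDF ((x - a * n) / c) ∂(gaussianReal 0 1) = stdCDF x := by
  obtain ⟨va, hva⟩ : ∃ v : NNReal, (v : ℝ) = a ^ 2 := ⟨(a ^ 2).toNNReal, by simp [sq_nonneg]⟩
  obtain ⟨vc, hvc⟩ : ∃ v : NNReal, (v : ℝ) = c ^ 2 := ⟨(c ^ 2).toNNReal, by simp [sq_nonneg]⟩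
  have h1 : (gaussianReal 0 1).map (fun n => a * n) = gaussianReal 0 va := by
    rw [gaussianReal_map_const_mul]
    congr 1
    · simp
    · ext; simp [hva]
  have h2 := cdf_conv_gaussianReal (gaussianReal 0 va) hc hvc x
  have h3 : va + vc = 1 := by ext; push_cast; rw [hva, hvc, hac]
  rw [gaussianReal_conv_gaussianReal, h3, add_zero, ← h1,
    integral_map (f := fun y => stdCDF ((x - y) / c)) (by fun_prop)
    (stdCDF_mono.measurable.comp
      (by fun_prop : Measurable fun y => (x - y) / c)).aestronglyMeasurable]
    at h2
  rw [← h2, stdCDF]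

/-- Chebyshev-type parabolic majorant of the normal distribution function. -/
lemma stdCDF_le_parabola {k : ℝ} (hk : 0 ≤ k) (v : ℝ) :
    stdCDF v ≤ (1 + k * v) ^ 2 + k ^ 2 := by
  have h := isCenteredLaw_gaussianReal.integral_le (f := (Set.Iic v).indicator 1)
    ((integrable_const (1 : ℝ)).indicator measurableSet_Iic)
    (A := (1 + k * v) ^ 2) (q := -(2 * (1 + k * v) * k)) (m := k ^ 2) (k := 0) fun n => by
      have e : (1 + k * v) ^ 2 + -(2 * (1 + k * v) * k) * n + k ^ 2 * n ^ 2 + 0 * |n| ^ 3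
        = (1 + k * (v - n)) ^ 2 := by ring
      rw [e]
      by_cases hn : n ≤ v
      · have := mul_nonneg hk (sub_nonneg.2 hn)
        rw [Set.indicator_of_mem (Set.mem_Iic.2 hn), Pi.one_apply]; nlinarith
      · rw [Set.indicator_of_notMem (by simpa using hn)]; positivity
  rw [integral_indicator_one measurableSet_Iic] at h
  rw [stdCDF, cdf_eq_real]
  simpa using h

lemma stdCDF_add_ge_three (v u : ℝ) :
    stdCDF v + stdPDF v * u + -v * stdPDF v / 2 * u ^ 2 - 0.0665 * |u| ^ 3
      ≤ stdCDF (v + u) := by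
  have h := stdCDF_add_le_three (-v) (-u)
  rw [← neg_add, stdCDF_neg, stdCDF_neg, stdPDF_neg, abs_neg] at h
  linarith

section SmoothedLaw

variable {ν : Measure ℝ} [IsProbabilityMeasure ν] {a c x : ℝ}

lemma IsCenteredLaw.smoothed_le_three (h : IsCenteredLaw ν a) (hc : 0 < c) (x : ℝ) :
    ∫ y, stdCDF ((x - y) / c) ∂ν ≤ stdCDF (x / c)
      + -(x / c) * stdPDF (x / c) / 2 / c ^ 2 * a ^ 2 + 0.0665 / c ^ 3 * ∫ y, |y| ^ 3 ∂ν := by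
  refine h.integral_le (q := -stdPDF (x / c) / c) (integrable_stdCDF_comp (by fun_prop))
    fun y => ?_
  have := stdCDF_add_le_three (x / c) (-y / c)
  rw [← add_div, ← sub_eq_add_neg, abs_div, abs_neg, abs_of_pos hc] at this
  refine this.trans (le_of_eq ?_)
  field_simp

lemma IsCenteredLaw.smoothed_le_two (h : IsCenteredLaw ν a) (hc : 0 < c) (x : ℝ) :
    ∫ y, stdCDF ((x - y) / c) ∂ν ≤ stdCDF (x / c) + 0.121 / c ^ 2 * a ^ 2 := by
  have := h.integral_le (A := stdCDF (x / c)) (q := -stdPDF (x / c) / c)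
    (m := 0.121 / c ^ 2) (k := 0)
    (integrable_stdCDF_comp (g := fun y => (x - y) / c) (by fun_prop)) fun y => by
      have := stdCDF_add_le_two (x / c) (-y / c)
      rw [← add_div, ← sub_eq_add_neg] at this
      refine this.trans (le_of_eq ?_)
      field_simp
      ring
  simpa using this

lemma IsCenteredLaw.smoothed_le_one (x c : ℝ) : ∫ y, stdCDF ((x - y) / c) ∂ν ≤ 1 := by
  refine (integral_mono (g := fun _ => (1 : ℝ)) (integrable_stdCDF_comp (by fun_prop))
    (integrable_const _) fun y => stdCDF_le_one _).trans ?_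
  simp

lemma IsCenteredLaw.smoothed_le_cantelli (h : IsCenteredLaw ν a) (hc : 0 < c)
    (hac : a ^ 2 + c ^ 2 = 1) {z : ℝ} (hz : 0 ≤ z) :
    ∫ y, stdCDF ((-z - y) / c) ∂ν ≤ 1 / (1 + z ^ 2) := by
  have hz2 : 0 < 1 + z ^ 2 := by positivity
  have := h.integral_le (A := (1 + c ^ 2 * z ^ 2) / (1 + z ^ 2) ^ 2)
    (q := -(2 * z) / (1 + z ^ 2) ^ 2)
    (m := z ^ 2 / (1 + z ^ 2) ^ 2) (k := 0)
    (integrable_stdCDF_comp (g := fun y => (-z - y) / c) (by fun_prop)) fun y => by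
      have := stdCDF_le_parabola (k := c * z / (1 + z ^ 2)) (by positivity) ((-z - y) / c)
      refine this.trans (le_of_eq ?_)
      field_simp
      ring
  refine this.trans (le_of_eq ?_)
  field_simp
  linear_combination z ^ 2 * hac

/-- The bound for a small non-Gaussian part, by comparing third-order expansions. -/
lemma IsCenteredLaw.smoothed_le_of_le (h : IsCenteredLaw ν a) (ha : 0 < a) (hc : 0 < c)
    (hac : a ^ 2 + c ^ 2 = 1) (ha' : a ≤ 0.72) (x : ℝ) :
    ∫ y, stdCDF ((x - y) / c) ∂ν ≤ stdCDF x + 0.56 * ∫ y, |y| ^ 3 ∂ν := by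
  have h1 := h.smoothed_le_three hc x
  have h2 := isCenteredLaw_gaussianReal.integral_le
    (f := fun n => -stdCDF ((x - a * n) / c)) (A := -stdCDF (x / c))
    (q := stdPDF (x / c) * a / c)
    (m := (x / c) * stdPDF (x / c) / 2 / c ^ 2 * a ^ 2) (k := 0.0665 / c ^ 3 * a ^ 3)
    (integrable_stdCDF_comp (by fun_prop)).neg fun n => by
      have := stdCDF_add_ge_three (x / c) (-(a * n) / c)
      rw [← add_div, ← sub_eq_add_neg, abs_div, abs_neg, abs_of_pos hc, abs_mul,
        abs_of_pos ha] at this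
      refine (neg_le_neg this).trans (le_of_eq ?_)
      field_simp
      ring
  rw [integral_neg, integral_stdCDF_gaussianReal hc hac] at h2
  have h3 := h.cube_le ha.le
  have h4 := integral_abs_cube_gaussianReal
  have hc1 : 0.693 ≤ c := by
    by_contra! hlt
    norm_num at *; nlinarith
  have hc3 : 0.3328 ≤ c ^ 3 :=
    le_trans (by norm_num) (pow_le_pow_left₀ (by norm_num) hc1 3)
  set β := ∫ y, |y| ^ 3 ∂ν
  have ha3 : 0 < a ^ 3 := by positivity
  have h5 : 0.0665 / c ^ 3 * a ^ 3 * ∫ y, |y| ^ 3 ∂(gaussianReal 0 1)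
      ≤ 0.0665 / c ^ 3 * β * 1.6 := by
    gcongr
  have h6 : 0.0665 / c ^ 3 * (2.6 * β) ≤ 0.56 * β := by
    rw [div_mul_eq_mul_div, div_le_iff₀ (by positivity)]
    have : 0.3328 * β ≤ c ^ 3 * β := mul_le_mul_of_nonneg_right hc3 (by linarith)
    norm_num at *; linarith
  have e1 : -(x / c) * stdPDF (x / c) / 2 / c ^ 2 * a ^ 2 =
    -((x / c) * stdPDF (x / c) / 2 / c ^ 2 * a ^ 2 * 1 ^ 2) := by ring
  rw [e1] at h1
  norm_num at *; linarith

lemma stdCDF_div_sub_le (hc : 0.51 ≤ c) (hc1 : c ≤ 1) (hx0 : 0 ≤ x) (hx : x ≤ 0.82) :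
    stdCDF (x / c) - stdCDF x ≤ (x / c) * stdPDF (x / c) / 2 / c ^ 2 * (1 - c ^ 2) := by
  have hc0 : 0 < c := lt_of_lt_of_le (by norm_num) hc
  have hle : x ≤ x / c := le_div_self hx0 hc0 hc1
  have h1 : stdCDF (x / c) - stdCDF x ≤ stdPDF x * (x / c - x) := by
    refine Convex.image_sub_le_mul_sub_of_deriv_le (convex_Ici x)
      (fun s _ => (hasDerivAt_stdCDF s).continuousAt.continuousWithinAt)
      (fun s _ => (hasDerivAt_stdCDF s).differentiableAt.differentiableWithinAt)
      (fun s hs => ?_) x Set.self_mem_Ici (x / c) hle hle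
    rw [interior_Ici] at hs
    rw [(hasDerivAt_stdCDF s).deriv, stdPDF_eq s, stdPDF_eq x]
    have : x < s := hs
    refine mul_le_mul_of_nonneg_left (exp_le_exp.2 ?_) (stdPDF_pos 0).le
    nlinarith
  set s := x ^ 2 * (1 - c ^ 2) / c ^ 2 / 2 with hs
  have h2 : stdPDF x = stdPDF (x / c) * exp s := by
    rw [stdPDF_eq x, stdPDF_eq (x / c), mul_assoc, ← exp_add]
    congr 2; rw [hs]; field_simp; ring
  have hexp : exp s ≤ (1 + c) / (2 * c ^ 2) := by
    have hs0 : 0 ≤ s := by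
      have : c ^ 2 ≤ 1 := by nlinarith
      have : 0 ≤ 1 - c ^ 2 := by linarith
      positivity
    have hs1 : s * c ^ 2 ≤ 0.3362 * (1 - c ^ 2) := by
      have e : s * c ^ 2 = x ^ 2 / 2 * (1 - c ^ 2) := by rw [hs]; field_simp
      rw [e]
      refine mul_le_mul_of_nonneg_right ?_ (by nlinarith)
      norm_num at *; nlinarith
    have hs2 : s ≤ 1 := by
      by_contra! hlt
      norm_num at *; nlinarith
    have hchord := convexOn_exp.2 (Set.mem_univ 0) (Set.mem_univ 1) (sub_nonneg.2 hs2) hs0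
      (by ring)
    simp only [smul_eq_mul, mul_zero, mul_one, zero_add, exp_zero] at hchord
    have he := exp_one_lt_d9
    have h3 : exp s ≤ 1 + 1.7183 * s := by norm_num at *; nlinarith
    rw [le_div_iff₀ (by positivity)]
    have h4 := mul_le_mul_of_nonneg_right h3 (by positivity : 0 ≤ 2 * c ^ 2)
    norm_num at *; nlinarith
  refine h1.trans ?_
  rw [h2]
  have e : x / c * stdPDF (x / c) / 2 / c ^ 2 * (1 - c ^ 2) =
    stdPDF (x / c) * ((1 + c) / (2 * c ^ 2)) * (x / c - x) := by field_simp; ring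
  rw [e]
  gcongr
  exact (stdPDF_pos _).le

lemma IsCenteredLaw.smoothed_le_mid_nonneg (h : IsCenteredLaw ν a) (hc : 0 < c)
    (hac : a ^ 2 + c ^ 2 = 1) (ha : 0.72 ≤ a) (ha' : a ≤ 0.86) (hx : 0 ≤ x) :
    ∫ y, stdCDF ((x - y) / c) ∂ν ≤ stdCDF x + 0.56 * ∫ y, |y| ^ 3 ∂ν := by
  have ha0 : 0 ≤ a := le_trans (by norm_num) ha
  have hβ := h.cube_le ha0
  rcases le_total x 0.82 with hx' | hx'
  · have hc1 : 0.51 ≤ c := by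
      by_contra! hlt
      norm_num at *; nlinarith
    have h1 := h.smoothed_le_three hc x
    have h2 := stdCDF_div_sub_le hc1 (by nlinarith) hx hx'
    have h3 : 0.0665 / c ^ 3 ≤ 0.56 := by
      rw [div_le_iff₀ (by positivity)]
      have := pow_le_pow_left₀ (by norm_num) hc1 3
      norm_num at *; linarith
    have h4 := mul_le_mul_of_nonneg_right h3 (le_trans (by positivity) hβ)
    rw [← hac] at h2
    have e : -(x / c) * stdPDF (x / c) / 2 / c ^ 2 * a ^ 2
      = -((x / c) * stdPDF (x / c) / 2 / c ^ 2 * (a ^ 2 + c ^ 2 - c ^ 2)) := by ring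
    linarith
  · have h1 := IsCenteredLaw.smoothed_le_one (ν := ν) x c
    have h2 := le_stdCDF_082.trans (stdCDF_mono hx')
    have h3 := pow_le_pow_left₀ (by norm_num) ha 3
    norm_num at *; linarith

lemma IsCenteredLaw.smoothed_le_mid_nonpos (h : IsCenteredLaw ν a) (hc : 0 < c)
    (hac : a ^ 2 + c ^ 2 = 1) (ha : 0.72 ≤ a) (ha' : a ≤ 0.86) (hx : x ≤ 0) :
    ∫ y, stdCDF ((x - y) / c) ∂ν ≤ stdCDF x + 0.56 * ∫ y, |y| ^ 3 ∂ν := by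
  have ha0 : 0 < a := lt_of_lt_of_le (by norm_num) ha
  have hβ := h.cube_le ha0.le
  have h1 := h.smoothed_le_two hc x
  have h2 : stdCDF (x / c) ≤ stdCDF x := stdCDF_mono <| by
    rw [div_le_iff₀ hc]; nlinarith
  have h3 : 0.121 / c ^ 2 * a ^ 2 ≤ 0.56 * a ^ 3 := by
    rw [div_mul_eq_mul_div, div_le_iff₀ (by positivity)]
    have : 0.121 ≤ 0.56 * a * c ^ 2 := by
      rw [← eq_sub_iff_add_eq'] at hac
      rw [hac]
      norm_num at *
      nlinarith [mul_nonneg (sub_nonneg.2 ha) (sub_nonneg.2 ha'),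
        mul_nonneg (mul_nonneg (sub_nonneg.2 ha) (sub_nonneg.2 ha')) ha0.le]
    nlinarith [mul_le_mul_of_nonneg_right this (sq_nonneg a)]
  linarith

lemma IsCenteredLaw.smoothed_le_of_majorant (h : IsCenteredLaw ν a) {a₀ p m : ℝ} (hm : 0 ≤ m)
    (ha₀ : 0 ≤ a₀) (ha : a₀ ≤ a)
    (hle : ∀ y, stdCDF ((x - y) / c) ≤
      stdCDF x - p * y + m * (a₀ ^ 2 - y ^ 2) + 0.56 * |y| ^ 3) :
    ∫ y, stdCDF ((x - y) / c) ∂ν ≤ stdCDF x + 0.56 * ∫ y, |y| ^ 3 ∂ν := by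
  have := h.integral_le (A := stdCDF x + m * a₀ ^ 2) (q := -p) (m := -m) (k := 0.56)
    (integrable_stdCDF_comp (g := fun y => (x - y) / c) (by fun_prop)) fun y =>
      (hle y).trans (le_of_eq (by ring))
  have h2 := mul_le_mul_of_nonneg_left (pow_le_pow_left₀ ha₀ ha 2) hm
  linarith

end SmoothedLaw

section LargeNonGaussianPart

variable {ν : Measure ℝ} [IsProbabilityMeasure ν] {a c x y z : ℝ}

lemma stdCDF_le_half (hc : 0 < c) (hy : x ≤ y) : stdCDF ((x - y) / c) ≤ 1 / 2 := by
  rw [← stdCDF_zero]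
  exact stdCDF_mono (div_nonpos_of_nonpos_of_nonneg (by linarith) hc.le)

lemma stdCDF_le_of_mul_le {t : ℝ} (hc : 0 < c) (hy : t * c ≤ y - x) :
    stdCDF ((x - y) / c) ≤ stdCDF (-t) :=
  stdCDF_mono (by rw [div_le_iff₀ hc]; linarith)

lemma majorant_nonneg (hc : 0 < c) (hx : 0 ≤ x) (hx' : x ≤ 0.37) (y : ℝ) :
    stdCDF ((x - y) / c) ≤
      stdCDF x - 0.23 * y + 0.7224 * (0.86 ^ 2 - y ^ 2) + 0.56 * |y| ^ 3 := by
  have hS := linear_le_stdCDF hx hx'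
  rcases le_total x y with hy | hy
  · rw [abs_of_nonneg (hx.trans hy)]
    refine (stdCDF_le_half hc hy).trans ?_
    have hy0 := hx.trans hy
    norm_num at *
    nlinarith [mul_nonneg hy0 (sq_nonneg (y - 1)), sq_nonneg (y - 1)]
  refine (stdCDF_le_one _).trans ?_
  rcases le_total 0 y with hy0 | hy0
  · rw [abs_of_nonneg hy0]
    have : y ≤ 0.37 := hy.trans hx'
    norm_num at *
    nlinarith [mul_nonneg hy0 (sub_nonneg.2 this), pow_nonneg hy0 3]
  · rw [abs_of_nonpos hy0]
    obtain ⟨w, rfl⟩ : ∃ w, y = -w := ⟨-y, by ring⟩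
    have hw : 0 ≤ w := by linarith
    norm_num at *
    nlinarith [mul_nonneg hw (sq_nonneg (w - 3 / 5)), sq_nonneg (w - 3 / 5)]

lemma majorant_neg_near (hc : 0 < c) (hc' : c ≤ 0.511) (hz : 0 ≤ z) (hz' : z ≤ 0.4) (y : ℝ) :
    stdCDF ((-z - y) / c) ≤
      stdCDF (-z) - 0.52 * y + 0.7224 * (0.86 ^ 2 - y ^ 2) + 0.56 * |y| ^ 3 := by
  have hS : 1 / 2 - 0.399 * z + 0.0648 * z ^ 3 ≤ stdCDF (-z) := by
    refine le_trans ?_ (quintic_le_stdCDF_neg hz)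
    have h5 : z ^ 5 ≤ 0.16 * z ^ 3 := by
      have : z ^ 2 ≤ 0.16 := by norm_num at *; nlinarith
      nlinarith [mul_le_mul_of_nonneg_right this (pow_nonneg hz 3)]
    have := pow_nonneg hz 3
    norm_num at *; linarith
  have hz3 := pow_nonneg hz 3
  rcases le_total y (-z) with hy | hy
  · refine (stdCDF_le_one _).trans ?_
    rw [abs_of_nonpos (by linarith)]
    obtain ⟨s, hs⟩ : ∃ s, y = -(z + s) := ⟨-y - z, by ring⟩
    subst hs
    have hs0 : 0 ≤ s := by linarith
    have hpoly : 0 ≤ 0.03429 + 0.121 * z - 0.7224 * z ^ 2 + 0.6248 * z ^ 3 := by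
      norm_num at *
      nlinarith [mul_nonneg hz (sub_nonneg.2 hz'), mul_nonneg hz (sq_nonneg (z - 2 / 5)),
        sq_nonneg (z - 2 / 5)]
    have hmono : 0 ≤ s * (0.52 - 0.7224 * (2 * z + s)
        + 0.56 * (3 * z ^ 2 + 3 * z * s + s ^ 2)) := by
      refine mul_nonneg hs0 ?_
      norm_num at *
      nlinarith [sq_nonneg (z + s / 2 - 0.43), sq_nonneg s]
    norm_num at *; nlinarith
  rcases le_total (0.511 - z) y with hy1 | hy1
  · have hy0 : 0 ≤ y := by norm_num at *; linarith
    rw [abs_of_nonneg hy0]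
    refine (stdCDF_le_of_mul_le (t := 1) hc (by linarith)).trans
      (stdCDF_neg_one_le.trans ?_)
    norm_num at *
    nlinarith [mul_nonneg hy0 (sq_nonneg (y - 1.13)), sq_nonneg (y - 1.13)]
  · refine (stdCDF_le_half hc hy).trans ?_
    rcases le_total 0 y with hy0 | hy0
    · rw [abs_of_nonneg hy0]
      have h1 : y ≤ 0.511 := by linarith
      norm_num at *
      nlinarith [mul_nonneg hy0 (sub_nonneg.2 h1), pow_nonneg hy0 3]
    · rw [abs_of_nonpos hy0]
      have h1 : y ^ 2 ≤ 0.16 := by norm_num at *; nlinarith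
      have := pow_nonneg (neg_nonneg.2 hy0) 3
      norm_num at *; linarith

lemma majorant_neg_far (hc : 0 < c) (hc' : c ≤ 0.436) (hz : 0.4 ≤ z) (hz' : z ≤ 0.8) (y : ℝ) :
    stdCDF ((-z - y) / c) ≤
      stdCDF (-z) - 0.48 * y + 0.756 * (0.9 ^ 2 - y ^ 2) + 0.56 * |y| ^ 3 := by
  have hz0 : 0 ≤ z := le_trans (by norm_num) hz
  have hS : 1 / 2 - 0.39895 * z + 0.0601 * z ^ 3 ≤ stdCDF (-z) := by
    refine le_trans ?_ (quintic_le_stdCDF_neg hz0)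
    have h5 : z ^ 5 ≤ 0.64 * z ^ 3 := by
      have : z ^ 2 ≤ 0.64 := by norm_num at *; nlinarith
      nlinarith [mul_le_mul_of_nonneg_right this (pow_nonneg hz0 3)]
    have := pow_nonneg hz0 3
    norm_num at *; linarith
  have hS' : 0.211 ≤ stdCDF (-z) := by
    refine le_trans ?_ (stdCDF_mono (neg_le_neg hz'))
    refine le_trans ?_ (quintic_le_stdCDF_neg (by norm_num))
    norm_num
  rcases le_total y (-z) with hy | hy
  · refine (stdCDF_le_one _).trans ?_
    rw [abs_of_nonpos (by linarith)]
    obtain ⟨s, hs⟩ : ∃ s, y = -(z + s) := ⟨-y - z, by ring⟩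
    subst hs
    have hs0 : 0 ≤ s := by linarith
    have hpoly : 0 ≤ 0.11236 + 0.08105 * z - 0.756 * z ^ 2 + 0.6201 * z ^ 3 := by
      norm_num at *
      nlinarith [mul_nonneg hz0 (sq_nonneg (z - 0.76)), sq_nonneg (z - 0.76)]
    have hmono : 0 ≤ s * (0.48 - 0.756 * (2 * z + s)
        + 0.56 * (3 * z ^ 2 + 3 * z * s + s ^ 2)) := by
      refine mul_nonneg hs0 ?_
      norm_num at *
      nlinarith [sq_nonneg (z + s / 2 - 0.45), sq_nonneg s]
    norm_num at *; nlinarith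
  rcases le_total (0.62 - z) y with hy1 | hy1
  · refine (stdCDF_le_of_mul_le (t := 1.4) hc (by norm_num at *; linarith)).trans
      (stdCDF_neg_seven_fifths_le.trans ?_)
    rcases le_total 0 y with hy0 | hy0
    · rw [abs_of_nonneg hy0]
      norm_num at *
      nlinarith [mul_nonneg hy0 (sq_nonneg (y - 1.15)), sq_nonneg (y - 1.15)]
    · rw [abs_of_nonpos hy0]
      have h1 : y ^ 2 ≤ 0.64 := by norm_num at *; nlinarith
      have := pow_nonneg (neg_nonneg.2 hy0) 3
      norm_num at *; linarith
  · refine (stdCDF_le_half hc hy).trans ?_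
    rcases le_total 0 y with hy0 | hy0
    · rw [abs_of_nonneg hy0]
      have h1 : y ≤ 0.22 := by norm_num at *; linarith
      norm_num at *
      nlinarith [mul_nonneg hy0 (sub_nonneg.2 h1), pow_nonneg hy0 3]
    · rw [abs_of_nonpos hy0]
      obtain ⟨w, rfl⟩ : ∃ w, y = -w := ⟨-y, by ring⟩
      have hw : 0 ≤ w := by linarith
      have hw' : w ≤ 0.8 := by linarith
      norm_num at *
      nlinarith [mul_nonneg hw (sub_nonneg.2 hw'), pow_nonneg hw 3,
        mul_nonneg hw (sq_nonneg (w - 0.8))]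

lemma cantelli_le_of_one_le (hz : 1 ≤ z) : 1 / (1 + z ^ 2) ≤ stdCDF (-z) + 0.356 := by
  have hz2 : 0 < 1 + z ^ 2 := by positivity
  rw [div_le_iff₀ hz2]
  rcases le_total z 1.35 with h | h
  · have hS := quintic_le_stdCDF_neg (z := z) (by linarith)
    have hL : 0.156 - 0.25 * (z - 1) ≤ stdCDF (-z) := by
      refine le_trans ?_ hS
      norm_num at *
      obtain ⟨s, rfl⟩ : ∃ s, z = 1 + s := ⟨z - 1, by ring⟩
      have hs : 0 ≤ s := by linarith
      have hs' : s ≤ 7 / 20 := by linarith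
      nlinarith [pow_nonneg hs 2, pow_nonneg hs 3, pow_nonneg hs 4,
        mul_nonneg hs (sub_nonneg.2 hs'), mul_nonneg (pow_nonneg hs 2) (sub_nonneg.2 hs'),
        mul_nonneg (pow_nonneg hs 3) (sub_nonneg.2 hs'),
        mul_nonneg (pow_nonneg hs 4) (sub_nonneg.2 hs')]
    refine le_trans ?_ (mul_le_mul_of_nonneg_right (add_le_add_left hL _) hz2.le)
    norm_num at *
    nlinarith [mul_nonneg (sub_nonneg.2 hz) (sub_nonneg.2 h),
      mul_nonneg (mul_nonneg (sub_nonneg.2 hz) (sub_nonneg.2 h)) (sub_nonneg.2 hz)]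
  · have := stdCDF_nonneg (-z)
    norm_num at *; nlinarith

lemma cantelli_le_of_four_fifths_le (hz : 0.8 ≤ z) :
    1 / (1 + z ^ 2) ≤ stdCDF (-z) + 0.408 := by
  have hz2 : 0 < 1 + z ^ 2 := by positivity
  rw [div_le_iff₀ hz2]
  rcases le_total z 1.21 with h | h
  · have hS := quintic_le_stdCDF_neg (z := z) (le_trans (by norm_num) hz)
    have hL : 0.211 - 0.3 * (z - 0.8) ≤ stdCDF (-z) := by
      refine le_trans ?_ hS
      obtain ⟨s, rfl⟩ : ∃ s, z = 0.8 + s := ⟨z - 0.8, by ring⟩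
      have hs : 0 ≤ s := by linarith
      have hs' : s ≤ 0.41 := by norm_num at *; linarith
      norm_num at *
      nlinarith [pow_nonneg hs 2, pow_nonneg hs 3, pow_nonneg hs 4,
        mul_nonneg hs (sub_nonneg.2 hs'), mul_nonneg (pow_nonneg hs 2) (sub_nonneg.2 hs'),
        mul_nonneg (pow_nonneg hs 3) (sub_nonneg.2 hs'),
        mul_nonneg (pow_nonneg hs 4) (sub_nonneg.2 hs')]
    refine le_trans ?_ (mul_le_mul_of_nonneg_right (add_le_add_left hL _) hz2.le)
    norm_num at *
    nlinarith [mul_nonneg (sub_nonneg.2 hz) (sub_nonneg.2 h),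
      mul_nonneg (mul_nonneg (sub_nonneg.2 hz) (sub_nonneg.2 h)) (sub_nonneg.2 hz)]
  · have := stdCDF_nonneg (-z)
    norm_num at *; nlinarith

lemma IsCenteredLaw.smoothed_le_gap (h : IsCenteredLaw ν a) (hc : 0 < c)
    (hac : a ^ 2 + c ^ 2 = 1) (ha : 0.86 ≤ a) (ha' : a ≤ 0.9) (hz : 0.4 ≤ z) (hz' : z ≤ 1) :
    ∫ y, stdCDF ((-z - y) / c) ∂ν ≤ stdCDF (-z) + 0.56 * ∫ y, |y| ^ 3 ∂ν := by
  have ha0 : 0 < a := lt_of_lt_of_le (by norm_num) ha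
  have hβ := h.cube_le ha0.le
  have h1 := h.smoothed_le_two hc (-z)
  have hc' : c ≤ 0.511 := by
    by_contra! hlt
    norm_num at *; nlinarith
  have h2 : stdCDF (-z / c) ≤ stdCDF (-(1.95 * z)) := stdCDF_mono <| by
    rw [div_le_iff₀ hc]
    norm_num at *; nlinarith
  have h3 := stdCDF_neg_gap hz hz'
  have h4 : 0.121 / c ^ 2 * a ^ 2 ≤ 0.11 + 0.56 * a ^ 3 := by
    rw [div_mul_eq_mul_div, div_le_iff₀ (by positivity)]
    have hc2 : c ^ 2 = 1 - a ^ 2 := by linarith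
    rw [hc2]
    obtain ⟨s, rfl⟩ : ∃ s, a = 0.9 - s := ⟨0.9 - a, by ring⟩
    have hs : 0 ≤ s := by linarith
    have hs' : s ≤ 0.04 := by norm_num at *; linarith
    norm_num at *
    nlinarith [pow_nonneg hs 2, pow_nonneg hs 3, pow_nonneg hs 4,
        mul_nonneg hs (sub_nonneg.2 hs'), mul_nonneg (pow_nonneg hs 2) (sub_nonneg.2 hs'),
        mul_nonneg (pow_nonneg hs 3) (sub_nonneg.2 hs'),
        mul_nonneg (pow_nonneg hs 4) (sub_nonneg.2 hs')]
  linarith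

/-- Berry–Esseen bound for a centered law smoothed by an independent centered Gaussian,
one-sided form. -/
lemma IsCenteredLaw.smoothed_le (h : IsCenteredLaw ν a) (ha0 : 0 < a) (hc : 0 < c)
    (hac : a ^ 2 + c ^ 2 = 1) (x : ℝ) :
    ∫ y, stdCDF ((x - y) / c) ∂ν ≤ stdCDF x + 0.56 * ∫ y, |y| ^ 3 ∂ν := by
  have hβ := h.cube_le ha0.le
  rcases le_total a 0.72 with h72 | h72
  · exact h.smoothed_le_of_le ha0 hc hac h72 x
  rcases le_total a 0.86 with h86 | h86
  · rcases le_total 0 x with hx | hx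
    · exact h.smoothed_le_mid_nonneg hc hac h72 h86 hx
    · exact h.smoothed_le_mid_nonpos hc hac h72 h86 hx
  have hc' : c ≤ 0.511 := by
    by_contra! hlt
    norm_num at *; nlinarith
  have ha3 := pow_le_pow_left₀ (by norm_num) h86 3
  rcases le_total 0 x with hx | hx
  · rcases le_total x 0.37 with hx' | hx'
    · exact h.smoothed_le_of_majorant (by norm_num) (by norm_num) h86
        (majorant_nonneg hc hx hx')
    · have h1 := IsCenteredLaw.smoothed_le_one (ν := ν) x c
      have h2 := le_stdCDF_037.trans (stdCDF_mono hx')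
      norm_num at *; linarith
  obtain ⟨z, rfl⟩ : ∃ z, x = -z := ⟨-x, by ring⟩
  have hz : 0 ≤ z := by linarith
  rcases le_total z 0.4 with hz4 | hz4
  · exact h.smoothed_le_of_majorant (by norm_num) (by norm_num) h86
      (majorant_neg_near hc hc' hz hz4)
  have hcant := h.smoothed_le_cantelli hc hac hz
  rcases le_total a 0.9 with h90 | h90
  · rcases le_total z 1 with hz1 | hz1
    · exact h.smoothed_le_gap hc hac h86 h90 hz4 hz1
    · have := cantelli_le_of_one_le hz1
      norm_num at *; linarith
  · rcases le_total z 0.8 with hz8 | hz8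
    · have hc'' : c ≤ 0.436 := by
        by_contra! hlt
        norm_num at *; nlinarith
      exact h.smoothed_le_of_majorant (by norm_num) (by norm_num) h90
        (majorant_neg_far hc hc'' hz4 hz8)
    · have := cantelli_le_of_four_fifths_le hz8
      have ha3' := pow_le_pow_left₀ (by norm_num) h90 3
      norm_num at *; linarith

end LargeNonGaussianPart

/-- Two-sided form of `IsCenteredLaw.smoothed_le`. -/
lemma IsCenteredLaw.abs_smoothed_sub_le {ν : Measure ℝ} [IsProbabilityMeasure ν] {a c : ℝ}
    (h : IsCenteredLaw ν a) (ha0 : 0 < a) (hc : 0 < c) (hac : a ^ 2 + c ^ 2 = 1) (x : ℝ) :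
    |∫ y, stdCDF ((x - y) / c) ∂ν - stdCDF x| ≤ 0.56 * ∫ y, |y| ^ 3 ∂ν := by
  have hneg : IsCenteredLaw (ν.map Neg.neg) a := by
    have hme : MeasurableEmbedding (Neg.neg : ℝ → ℝ) := measurableEmbedding_neg
    refine ⟨?_, ?_, ?_⟩
    · rw [hme.integrable_map_iff]
      simpa [Function.comp_def] using h.integrable_cube
    · rw [hme.integral_map, integral_neg, h.mean, neg_zero]
    · rw [hme.integral_map]
      simpa using h.second
  have hprob : IsProbabilityMeasure (ν.map Neg.neg) :=
    Measure.isProbabilityMeasure_map (by fun_prop)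
  have h1 := h.smoothed_le ha0 hc hac x
  have h2 := hneg.smoothed_le ha0 hc hac (-x)
  rw [measurableEmbedding_neg.integral_map, measurableEmbedding_neg.integral_map, stdCDF_neg] at h2
  have h3 : ∀ y, stdCDF ((-x - -y) / c) = 1 - stdCDF ((x - y) / c) := fun y => by
    rw [← stdCDF_neg]; congr 1; ring
  simp only [h3, abs_neg] at h2
  rw [integral_sub (integrable_const _) (integrable_stdCDF_comp (by fun_prop))] at h2
  simp at h2
  rw [abs_le]
  constructor <;> linarith

/-- The law of a rescaled centered random variable with finite third moment. -/
lemma isCenteredLaw_map {Ω : Type*} {mΩ : MeasurableSpace Ω} {P : Measure Ω}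
    [IsProbabilityMeasure P] {L : Ω → ℝ} {m v s : ℝ} (hL : Measurable L) (hLint : Integrable L P)
    (hm : m = ∫ ω, L ω ∂P) (hv0 : 0 ≤ v) (hv : ∫ ω, (L ω - m) ^ 2 ∂P = v)
    (hL3 : Integrable (fun ω => |L ω - m| ^ 3) P) (hs : 0 < s) :
    IsCenteredLaw (P.map fun ω => (L ω - m) / s) (√v / s) := by
  have hY : Measurable fun ω => (L ω - m) / s := by fun_prop
  refine ⟨?_, ?_, ?_⟩
  · rw [integrable_map_measure (by fun_prop) hY.aemeasurable]
    simpa [Function.comp_def, abs_div, abs_of_pos hs, div_pow] using hL3.div_const (s ^ 3)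
  · rw [integral_map hY.aemeasurable (by fun_prop), integral_div,
      integral_sub hLint (integrable_const m), ← hm]
    simp
  · rw [integral_map hY.aemeasurable (by fun_prop)]
    simp_rw [div_pow]
    rw [integral_div, hv, sq_sqrt hv0]

/-- Standardizing a Gaussian random variable up to a scale factor. -/
lemma map_sub_div_eq_gaussianReal {Ω : Type*} {mΩ : MeasurableSpace Ω} {P : Measure Ω}
    {G : Ω → ℝ} {m s : ℝ} {v : NNReal} (hGm : AEMeasurable G P)
    (hG : P.map G = gaussianReal m v) :
    P.map (fun ω => (G ω - m) / s) = gaussianReal 0 (v / .mk (s ^ 2) (sq_nonneg _)) := by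
  have h : (fun ω => (G ω - m) / s) = (fun t => t / s) ∘ (fun t => t - m) ∘ G := rfl
  rw [h, ← AEMeasurable.map_map_of_aemeasurable (by fun_prop) (by fun_prop),
    ← AEMeasurable.map_map_of_aemeasurable (by fun_prop) hGm, hG, gaussianReal_map_sub_const,
    gaussianReal_map_div_const, sub_self, zero_div]

/-- Behaviour of the cdf of a random variable under an increasing affine change of variable. -/
lemma cdf_map_sub_div {Ω : Type*} {mΩ : MeasurableSpace Ω} {P : Measure Ω}
    [IsProbabilityMeasure P] {X : Ω → ℝ} (hX : AEMeasurable X P) {s : ℝ} (hs : 0 < s) (m x : ℝ) :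
    cdf (P.map fun ω => (X ω - m) / s) ((x - m) / s) = cdf (P.map X) x := by
  have hZ : AEMeasurable (fun ω => (X ω - m) / s) P := by fun_prop
  have := Measure.isProbabilityMeasure_map hX
  have := Measure.isProbabilityMeasure_map hZ
  rw [cdf_eq_real, cdf_eq_real, map_measureReal_apply_of_aemeasurable hZ measurableSet_Iic,
    map_measureReal_apply_of_aemeasurable hX measurableSet_Iic]
  congr 1
  ext ω
  simp [div_le_div_iff_of_pos_right hs]

/-- Gaussian approximation of the dB-scale per-UE uplink interference power: for
`I_b = P₀ + L + G` with `L` an arbitrary random variable (mean `μ_L`, variance `σ_L² > 0`,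
finite third absolute central moment) and `G ∼ N(μ_G, σ_G²)` independent of `L`, the
Kolmogorov distance between the law of `I_b` and `N(μ_{Q_b}, σ_{Q_b}²)`, where
`μ_{Q_b} = P₀ + μ_L + μ_G` and `σ_{Q_b}² = σ_L² + σ_G²`, is at most
`τ = 0.56 · E|L − μ_L|³ / (√(σ_L² + σ_G²))³`. -/
theorem gaussian_approx_interference
    {Ω : Type*} [MeasureSpace Ω] [IsProbabilityMeasure (ℙ : Measure Ω)]
    (L G : Ω → ℝ) (P0 μG : ℝ) (σL2 σG2 : ℝ) (hσL : 0 < σL2) (hσG : 0 < σG2)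
    (hLmeas : Measurable L) (hLint : Integrable L ℙ)
    (μL : ℝ) (hμL : μL = ∫ ω, L ω)
    (hLvar : ∫ ω, (L ω - μL) ^ 2 = σL2)
    (hL3 : Integrable (fun ω => |L ω - μL| ^ 3) ℙ)
    (hG : Measure.map G ℙ = gaussianReal μG ⟨σG2, hσG.le⟩)
    (hindep : IndepFun L G ℙ)
    (x : ℝ) :
    |cdf (Measure.map (fun ω => P0 + L ω + G ω) ℙ) x
        - cdf (gaussianReal 0 1) ((x - (P0 + μL + μG)) / Real.sqrt (σL2 + σG2))|
      ≤ 0.56 * (∫ ω, |L ω - μL| ^ 3) / (Real.sqrt (σL2 + σG2)) ^ 3 := by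
  obtain ⟨v, hv⟩ : ∃ v : NNReal, v = ⟨σG2, hσG.le⟩ := ⟨_, rfl⟩
  have hvσ : (v : ℝ) = σG2 := by rw [hv]; rfl
  rw [← hv] at hG
  have hGm : AEMeasurable G ℙ := aemeasurable_of_map_neZero (by rw [hG]; infer_instance)
  set s := √(σL2 + σG2) with hs_def
  have hs : 0 < s := Real.sqrt_pos.2 (by positivity)
  have hs2 : s ^ 2 = σL2 + σG2 := Real.sq_sqrt (by positivity)
  have hY : Measurable fun ω => (L ω - μL) / s := by fun_prop
  have hcomp : IndepFun (fun ω => (L ω - μL) / s) (fun ω => (G ω - μG) / s) ℙ :=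
    hindep.comp (φ := fun t => (t - μL) / s) (ψ := fun t => (t - μG) / s)
      (by fun_prop) (by fun_prop)
  have := Measure.isProbabilityMeasure_map (μ := (ℙ : Measure Ω)) hY.aemeasurable
  have hc2 : ((v / .mk (s ^ 2) (sq_nonneg _) : NNReal) : ℝ) = (√σG2 / s) ^ 2 := by
    rw [div_pow, Real.sq_sqrt hσG.le, NNReal.coe_div, hvσ]
    rfl
  have hc : 0 < √σG2 / s := div_pos (Real.sqrt_pos.2 hσG) hs
  have hsum : (fun ω => (P0 + L ω + G ω - (P0 + μL + μG)) / s)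
      = (fun ω => (L ω - μL) / s) + fun ω => (G ω - μG) / s := by
    ext ω
    simp only [Pi.add_apply]
    ring
  have hcube : ∫ y, |y| ^ 3 ∂(Measure.map (fun ω => (L ω - μL) / s) ℙ)
      = (∫ ω, |L ω - μL| ^ 3) / s ^ 3 := by
    rw [integral_map hY.aemeasurable (by fun_prop), ← integral_div]
    simp_rw [abs_div, abs_of_pos hs, div_pow]
  rw [← cdf_map_sub_div (by fun_prop) hs (P0 + μL + μG), hsum,
    hcomp.map_add_eq_map_conv_map₀ (by fun_prop) (by fun_prop),
    map_sub_div_eq_gaussianReal hGm hG, cdf_conv_gaussianReal _ hc hc2, mul_div_assoc, ← hcube]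
  refine (isCenteredLaw_map hLmeas hLint hμL hσL.le hLvar hL3 hs).abs_smoothed_sub_le
    (div_pos (Real.sqrt_pos.2 hσL) hs) hc ?_ _
  rw [div_pow, div_pow, Real.sq_sqrt hσL.le, Real.sq_sqrt hσG.le, ← add_div, hs2]
  exact div_self (by positivity)
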